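/- For all r, s ∈ {1,…,m} the following three identities hold (with the convention σ_j = 0 for j > m): (1) ∑_{j=1}^m σ_{r−1}(x̂_j) σ_{s−1}(x̂_j) x_j^(m+1) / Δ_j = σ_r σ_s − σ_{r+s}; (2) ∑_{j=1}^m σ_{r−1}(x̂_j) σ_{s−1}(x̂_j) x_j^(m+2) / Δ_j = σ₁ σ_r σ_s − σ_{r+1} σ_s − σ_r σ_{s+1} + σ_{r+s+1}; (3) ∑_{j=1}^m σ_{r−1}(x̂_j) σ_{s−1}(x̂_j) x_j^(m+3) / Δ_j = (σ₁² − σ₂) σ_r σ_s − σ₁ (σ_r σ_{s+1} + σ_{r+1} σ_s) + σ_r σ_{s+2} + σ_{r+2} σ_s + σ_{r+1} σ_{s+1} − σ_{r+s+2}. -/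

import Mathlib

noncomputable section

/-- The `r`-th elementary symmetric function of the values of `x` over the finite set `s`. -/
def esymmOn {n : ℕ} (s : Finset (Fin n)) (x : Fin n → ℝ) (r : ℕ) : ℝ :=
  ∑ t ∈ s.powersetCard r, ∏ i ∈ t, x i

/-- `σ_r(x₁,…,x_n)`, the `r`-th elementary symmetric polynomial of `x₁,…,x_n`. -/
def esymm {n : ℕ} (x : Fin n → ℝ) (r : ℕ) : ℝ :=
  esymmOn Finset.univ x r

/-- `σ_r(x̂_j)`, the `r`-th elementary symmetric polynomial of the `n - 1` numbers
`x_i`, `i ≠ j`. -/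
def esymmHat {n : ℕ} (x : Fin n → ℝ) (j : Fin n) (r : ℕ) : ℝ :=
  esymmOn (Finset.univ.erase j) x r

/-- `Δ_j(x) = ∏_{i ≠ j} (x_j - x_i)` (an empty product being `1`). -/
def Delta {n : ℕ} (x : Fin n → ℝ) (j : Fin n) : ℝ :=
  ∏ i ∈ Finset.univ.erase j, (x j - x i)

theorem esymmOn_zero {n : ℕ} (s : Finset (Fin n)) (x : Fin n → ℝ) : esymmOn s x 0 = 1 := by
  simp [esymmOn]

theorem esymmOn_insert_succ {n : ℕ} {s : Finset (Fin n)} {j : Fin n} (hj : j ∉ s)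
    (x : Fin n → ℝ) (r : ℕ) :
    esymmOn (insert j s) x (r + 1) = esymmOn s x (r + 1) + x j * esymmOn s x r := by
  unfold esymmOn
  have hmem : ∀ t ∈ s.powersetCard r, j ∉ t := fun t ht hjt =>
    hj ((Finset.mem_powersetCard.1 ht).1 hjt)
  rw [Finset.powersetCard_succ_insert hj, Finset.sum_union, Finset.sum_image, Finset.mul_sum]
  · congr 1
    exact Finset.sum_congr rfl fun t ht => Finset.prod_insert (hmem t ht)
  · intro t ht u hu h
    rw [← Finset.erase_insert (hmem t ht), h, Finset.erase_insert (hmem u hu)]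
  · refine Finset.disjoint_left.2 fun t ht hti => ?_
    obtain ⟨u, -, rfl⟩ := Finset.mem_image.1 hti
    exact hj ((Finset.mem_powersetCard.1 ht).1 (Finset.mem_insert_self j u))

theorem esymmHat_zero {n : ℕ} (x : Fin n → ℝ) (j : Fin n) : esymmHat x j 0 = 1 :=
  esymmOn_zero _ x

theorem esymmHat_succ {n : ℕ} (x : Fin n → ℝ) (j : Fin n) (r : ℕ) :
    esymmHat x j (r + 1) = esymm x (r + 1) - x j * esymmHat x j r := by
  have h := esymmOn_insert_succ (Finset.notMem_erase j Finset.univ) x r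
  rw [Finset.insert_erase (Finset.mem_univ j)] at h
  rw [esymm, h, esymmHat, esymmHat, add_sub_cancel_right]

theorem esymmHat_eq_zero {n : ℕ} (x : Fin n → ℝ) (j : Fin n) {r : ℕ} (hr : n ≤ r) :
    esymmHat x j r = 0 := by
  rw [esymmHat, esymmOn, Finset.powersetCard_eq_empty.2, Finset.sum_empty]
  have := j.pos
  rw [Finset.card_erase_of_mem (Finset.mem_univ j), Finset.card_univ, Fintype.card_fin]
  omega

theorem coeff_prod_X_sub_C_erase {n : ℕ} (x : Fin n → ℝ) (j : Fin n) {r : ℕ} (hr : r < n) :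
    (∏ i ∈ Finset.univ.erase j, (Polynomial.X - Polynomial.C (x i))).coeff (n - 1 - r)
      = (-1) ^ r * esymmHat x j r := by
  have hc : ((Finset.univ.erase j).val.map x).card = n - 1 := by
    rw [Multiset.card_map, Finset.card_val, Finset.card_erase_of_mem (Finset.mem_univ j),
      Finset.card_univ, Fintype.card_fin]
  have h := Multiset.prod_X_sub_C_coeff ((Finset.univ.erase j).val.map x)
    (k := n - 1 - r) (by omega)
  rw [Multiset.map_map, hc, show n - 1 - (n - 1 - r) = r by omega, Finset.esymm_map_val] at h
  exact h

theorem sum_prod_X_sub_C_erase {n : ℕ} {x : Fin n → ℝ} (hx : Function.Injective x)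
    {f : Polynomial ℝ} (hf : f.degree < n) :
    ∑ j, Polynomial.C (f.eval (x j) / Delta x j) *
      ∏ i ∈ Finset.univ.erase j, (Polynomial.X - Polynomial.C (x i)) = f := by
  conv_rhs => rw [Lagrange.eq_interpolate (s := Finset.univ) hx.injOn (f := f) (by simpa using hf)]
  rw [Lagrange.interpolate_apply]
  refine Finset.sum_congr rfl fun j _ => ?_
  simp only [Lagrange.basis, Lagrange.basisDivisor, Finset.prod_mul_distrib, div_eq_mul_inv,
    Delta, ← Finset.prod_inv_distrib, Polynomial.C_mul, map_prod, mul_assoc]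

theorem sum_esymmHat_mul_pow_pred_div_Delta {n : ℕ} {x : Fin n → ℝ} (hx : Function.Injective x)
    (hn : 1 ≤ n) (r : ℕ) :
    ∑ j, esymmHat x j r * x j ^ (n - 1) / Delta x j = if r = 0 then 1 else 0 := by
  rcases lt_or_ge r n with hr | hr
  · have h := congrArg (fun p => (-1) ^ r * Polynomial.coeff p (n - 1 - r))
      (sum_prod_X_sub_C_erase hx (f := Polynomial.X ^ (n - 1)) (by
        rw [Polynomial.degree_X_pow]; exact_mod_cast Nat.sub_lt hn one_pos))
    simp only [Polynomial.finsetSum_coeff, Polynomial.coeff_C_mul, Polynomial.coeff_X_pow,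
      coeff_prod_X_sub_C_erase x _ hr, Finset.mul_sum, Polynomial.eval_pow,
      Polynomial.eval_X] at h
    have hs : ((-1 : ℝ) ^ r) * (-1) ^ r = 1 := by rw [← mul_pow]; simp
    have hcond : n - 1 - r = n - 1 ↔ r = 0 := by omega
    simp only [hcond] at h
    calc _ = _ := Finset.sum_congr rfl fun j _ => ?_
      _ = _ := h
      _ = _ := by split_ifs with h0 <;> simp [h0]
    linear_combination (-(esymmHat x j r * x j ^ (n - 1) / Delta x j)) * hs
  · rw [if_neg (by omega)]
    exact Finset.sum_eq_zero fun j _ => by rw [esymmHat_eq_zero x j hr, zero_mul, zero_div]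

theorem sum_esymmHat_mul_pow_succ_div_Delta {n : ℕ} (x : Fin n → ℝ) (p r s : ℕ) :
    ∑ j, esymmHat x j r * esymmHat x j s * x j ^ (p + 1) / Delta x j
      = esymm x (s + 1) * ∑ j, esymmHat x j r * esymmHat x j 0 * x j ^ p / Delta x j
        - ∑ j, esymmHat x j r * esymmHat x j (s + 1) * x j ^ p / Delta x j := by
  rw [Finset.mul_sum, ← Finset.sum_sub_distrib]
  refine Finset.sum_congr rfl fun j _ => ?_
  rw [esymmHat_succ, esymmHat_zero]
  ring

theorem sum_esymmHat_mul_pow_div_Delta_comm {n : ℕ} (x : Fin n → ℝ) (p r s : ℕ) :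
    ∑ j, esymmHat x j r * esymmHat x j s * x j ^ p / Delta x j
      = ∑ j, esymmHat x j s * esymmHat x j r * x j ^ p / Delta x j :=
  Finset.sum_congr rfl fun j _ => by rw [mul_comm (esymmHat x j r)]

theorem sum_esymmHat_mul_pow_card_div_Delta {n : ℕ} {x : Fin n → ℝ} (hx : Function.Injective x)
    (hn : 1 ≤ n) (r s : ℕ) :
    ∑ j, esymmHat x j r * esymmHat x j s * x j ^ n / Delta x j = esymm x (r + s + 1) := by
  obtain ⟨p, rfl⟩ : ∃ p, n = p + 1 := ⟨n - 1, by omega⟩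
  have hS : ∀ r, ∑ j, esymmHat x j r * esymmHat x j 0 * x j ^ p / Delta x j
      = if r = 0 then 1 else 0 := fun r => by
    simpa [esymmHat_zero] using sum_esymmHat_mul_pow_pred_div_Delta hx hn r
  induction s generalizing r with
  | zero =>
    rw [sum_esymmHat_mul_pow_div_Delta_comm, sum_esymmHat_mul_pow_succ_div_Delta, hS,
      sum_esymmHat_mul_pow_div_Delta_comm, hS]
    simp
  | succ s ih =>
    have h₁ := sum_esymmHat_mul_pow_succ_div_Delta x p (s + 1) r
    have h₂ := sum_esymmHat_mul_pow_succ_div_Delta x p (r + 1) s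
    rw [hS, if_neg (Nat.succ_ne_zero _)] at h₁ h₂
    rw [sum_esymmHat_mul_pow_div_Delta_comm, h₁, sum_esymmHat_mul_pow_div_Delta_comm,
      show r + (s + 1) + 1 = r + 1 + s + 1 by omega, ← ih (r + 1), h₂]
    ring

/-- for pairwise distinct reals `x₁,…,x_m` and all `r, s ∈ {1,…,m}`
(with the convention `σ_j = 0` for `j > m`):
(1) `∑_j σ_{r−1}(x̂_j) σ_{s−1}(x̂_j) x_j^(m+1)/Δ_j = σ_r σ_s − σ_{r+s}`;
(2) `∑_j σ_{r−1}(x̂_j) σ_{s−1}(x̂_j) x_j^(m+2)/Δ_j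
      = σ₁ σ_r σ_s − σ_{r+1} σ_s − σ_r σ_{s+1} + σ_{r+s+1}`;
(3) `∑_j σ_{r−1}(x̂_j) σ_{s−1}(x̂_j) x_j^(m+3)/Δ_j
      = (σ₁² − σ₂) σ_r σ_s − σ₁(σ_r σ_{s+1} + σ_{r+1} σ_s)
        + σ_r σ_{s+2} + σ_{r+2} σ_s + σ_{r+1} σ_{s+1} − σ_{r+s+2}`. -/
theorem statement17 (m : ℕ) (hm : 1 ≤ m)
    (x : Fin m → ℝ) (hx : Function.Injective x)
    (r s : ℕ) (hr1 : 1 ≤ r) (hrm : r ≤ m) (hs1 : 1 ≤ s) (hsm : s ≤ m) :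
    (∑ j : Fin m, esymmHat x j (r - 1) * esymmHat x j (s - 1) * x j ^ (m + 1) / Delta x j
        = esymm x r * esymm x s - esymm x (r + s)) ∧
    (∑ j : Fin m, esymmHat x j (r - 1) * esymmHat x j (s - 1) * x j ^ (m + 2) / Delta x j
        = esymm x 1 * esymm x r * esymm x s - esymm x (r + 1) * esymm x s
          - esymm x r * esymm x (s + 1) + esymm x (r + s + 1)) ∧
    (∑ j : Fin m, esymmHat x j (r - 1) * esymmHat x j (s - 1) * x j ^ (m + 3) / Delta x j
        = (esymm x 1 ^ 2 - esymm x 2) * esymm x r * esymm x s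
          - esymm x 1 * (esymm x r * esymm x (s + 1) + esymm x (r + 1) * esymm x s)
          + esymm x r * esymm x (s + 2) + esymm x (r + 2) * esymm x s
          + esymm x (r + 1) * esymm x (s + 1) - esymm x (r + s + 2)) := by
  obtain ⟨r, rfl⟩ : ∃ q, r = q + 1 := ⟨r - 1, by omega⟩
  obtain ⟨s, rfl⟩ : ∃ q, s = q + 1 := ⟨s - 1, by omega⟩
  simp only [Nat.add_sub_cancel]
  have h₀ := sum_esymmHat_mul_pow_card_div_Delta hx hm
  have h₁ : ∀ r s, ∑ j, esymmHat x j r * esymmHat x j s * x j ^ (m + 1) / Delta x j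
      = esymm x (r + 1) * esymm x (s + 1) - esymm x (r + s + 2) := fun r s => by
    rw [sum_esymmHat_mul_pow_succ_div_Delta, h₀, h₀]
    ring_nf
  have h₂ : ∀ r s, ∑ j, esymmHat x j r * esymmHat x j s * x j ^ (m + 2) / Delta x j
      = esymm x 1 * esymm x (r + 1) * esymm x (s + 1) - esymm x (r + 2) * esymm x (s + 1)
        - esymm x (r + 1) * esymm x (s + 2) + esymm x (r + s + 3) := fun r s => by
    rw [sum_esymmHat_mul_pow_succ_div_Delta, h₁, h₁]
    ring_nf
  refine ⟨?_, ?_, ?_⟩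
  · rw [h₁]
    ring_nf
  · rw [h₂]
    ring_nf
  · rw [sum_esymmHat_mul_pow_succ_div_Delta, h₂, h₂]
    ring_nf

end
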